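/- arXiv:2007.06264 — 2 statements merged into one kernel-verified Lean document; each statement's English description precedes it below -/
import Mathlib

section
/- Let q ∈ (0,1), ζ₊ > 0, ζ₋ < 0. Suppose a = conj(b) ∈ ℂ∖ℝ and c = conj(d) ∈ ℂ∖ℝ, and that ab < cd·q (both products being positive reals). Then W(x; q; a,b,c,d) is a strictly positive real number for every x ∈ Λ, and the family (W(x; q; a,b,c,d))_{x∈Λ} is summable; consequently M(x) := W(x; q; a,b,c,d) / Σ_{y∈Λ} W(y; q; a,b,c,d) defines a probability distribution on Λ with strictly positive weights. -/
/-- The infinite q-Pochhammer symbol `(u; q)_∞ = ∏_{n=0}^∞ (1 - u qⁿ)`. -/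
noncomputable def qPochC (q : ℝ) (u : ℂ) : ℂ := ∏' n : ℕ, (1 - u * (q : ℂ) ^ n)

/-- The two-sided q-lattice `Λ = ζ₊ q^ℤ ∪ ζ₋ q^ℤ`. -/
def Lambda (q ζp ζm : ℝ) : Set ℝ := {x | ∃ n : ℤ, x = ζp * q ^ n ∨ x = ζm * q ^ n}

/-- The weight function `W(x; q; a,b,c,d) = (1-q)|x| (ax;q)_∞(bx;q)_∞ / ((cx;q)_∞(dx;q)_∞)`. -/
noncomputable def Wc (q : ℝ) (a b c d : ℂ) (x : ℝ) : ℂ :=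
  (((1 - q) * |x| : ℝ) : ℂ) * (qPochC q (a * x) * qPochC q (b * x)) /
    (qPochC q (c * x) * qPochC q (d * x))

open Filter Topology

section QPochhammer

variable {q : ℝ}

lemma summable_norm_mul_pow (hq0 : 0 < q) (hq1 : q < 1) (u : ℂ) :
    Summable fun n : ℕ => ‖-(u * (q : ℂ) ^ n)‖ := by
  simp only [norm_neg, norm_mul, norm_pow, Complex.norm_real, Real.norm_of_nonneg hq0.le]
  exact (summable_geometric_of_lt_one hq0.le hq1).mul_left _

lemma multipliable_one_sub_mul_pow (hq0 : 0 < q) (hq1 : q < 1) (u : ℂ) :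
    Multipliable fun n : ℕ => 1 - u * (q : ℂ) ^ n := by
  simpa only [sub_eq_add_neg] using
    multipliable_one_add_of_summable (summable_norm_mul_pow hq0 hq1 u)

lemma one_sub_ne_zero_of_im_ne_zero {u : ℂ} (hu : u.im ≠ 0) : 1 - u ≠ 0 := by
  intro h
  apply hu
  simpa using congrArg Complex.im h

lemma qPochC_ne_zero (hq0 : 0 < q) (hq1 : q < 1) {u : ℂ} (hu : u.im ≠ 0) :
    qPochC q u ≠ 0 := by
  have h := tprod_one_add_ne_zero_of_summable (f := fun n : ℕ => -(u * (q : ℂ) ^ n)) (fun n => by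
    rw [← sub_eq_add_neg, ← Complex.ofReal_pow]
    apply one_sub_ne_zero_of_im_ne_zero
    rw [Complex.im_mul_ofReal]
    exact mul_ne_zero hu (pow_pos hq0 n).ne') (summable_norm_mul_pow hq0 hq1 u)
  simpa only [qPochC, sub_eq_add_neg] using h

lemma qPochC_eq_one_sub_mul (hq0 : 0 < q) (hq1 : q < 1) (u : ℂ) :
    qPochC q u = (1 - u) * qPochC q (u * q) := by
  have h (n : ℕ) : 1 - u * (q : ℂ) ^ (n + 1) = 1 - u * q * (q : ℂ) ^ n := by ring
  unfold qPochC
  rw [tprod_eq_zero_mul' (by simpa only [h] using multipliable_one_sub_mul_pow hq0 hq1 (u * q))]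
  simp only [h, pow_zero, mul_one]

lemma qPochC_conj (hq0 : 0 < q) (hq1 : q < 1) (u : ℂ) :
    qPochC q ((starRingEnd ℂ) u) = (starRingEnd ℂ) (qPochC q u) := by
  unfold qPochC
  rw [(multipliable_one_sub_mul_pow hq0 hq1 u).map_tprod (starRingEnd ℂ) Complex.continuous_conj]
  simp

end QPochhammer

/-- The weight `Wc q (conj b) b (conj d) d x` as a manifestly nonnegative real number. -/
noncomputable def conjWeight (q : ℝ) (b d : ℂ) (x : ℝ) : ℝ :=
  (1 - q) * |x| * (‖qPochC q (b * x)‖ ^ 2 / ‖qPochC q (d * x)‖ ^ 2)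

section ConjWeight

variable {q : ℝ} {b d : ℂ}

lemma Wc_conj_eq (hq0 : 0 < q) (hq1 : q < 1) (b d : ℂ) (x : ℝ) :
    Wc q ((starRingEnd ℂ) b) b ((starRingEnd ℂ) d) d x = conjWeight q b d x := by
  have h (e : ℂ) : qPochC q ((starRingEnd ℂ) e * x) * qPochC q (e * x) =
      ((‖qPochC q (e * x)‖ ^ 2 : ℝ) : ℂ) := by
    rw [show (starRingEnd ℂ) e * (x : ℂ) = (starRingEnd ℂ) (e * x) by simp,
      qPochC_conj hq0 hq1, Complex.conj_mul', Complex.ofReal_pow]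
  rw [Wc, h, h, conjWeight]
  push_cast
  ring

lemma conjWeight_pos (hq0 : 0 < q) (hq1 : q < 1) (hb : b.im ≠ 0) (hd : d.im ≠ 0)
    {x : ℝ} (hx : x ≠ 0) : 0 < conjWeight q b d x := by
  have h {e : ℂ} (he : e.im ≠ 0) : 0 < ‖qPochC q (e * x)‖ :=
    norm_pos_iff.mpr <| qPochC_ne_zero hq0 hq1 <| by
      rw [Complex.im_mul_ofReal]; exact mul_ne_zero he hx
  have h1 := h hb
  have h2 := h hd
  have h3 : 0 < 1 - q := sub_pos.mpr hq1
  unfold conjWeight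
  positivity

lemma norm_one_sub_mul_ofReal_pos {e : ℂ} (he : e.im ≠ 0) {x : ℝ} (hx : x ≠ 0) :
    0 < ‖1 - e * x‖ :=
  norm_pos_iff.mpr <| one_sub_ne_zero_of_im_ne_zero <| by
    rw [Complex.im_mul_ofReal]; exact mul_ne_zero he hx

lemma conjWeight_mul_div (hq0 : 0 < q) (hq1 : q < 1) (hb : b.im ≠ 0) (hd : d.im ≠ 0)
    {x : ℝ} (hx : x ≠ 0) :
    conjWeight q b d (x * q) / conjWeight q b d x =
      q * (‖1 - d * x‖ ^ 2 / ‖1 - b * x‖ ^ 2) := by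
  have h {e : ℂ} (he : e.im ≠ 0) : 0 < ‖qPochC q (e * (x * q : ℝ))‖ :=
    norm_pos_iff.mpr <| qPochC_ne_zero hq0 hq1 <| by
      rw [Complex.im_mul_ofReal]; exact mul_ne_zero he (mul_ne_zero hx hq0.ne')
  have h1 := (h hb).ne'
  have h2 := (h hd).ne'
  have h3 := (norm_one_sub_mul_ofReal_pos hb hx).ne'
  have h4 := (norm_one_sub_mul_ofReal_pos hd hx).ne'
  have h5 : 1 - q ≠ 0 := (sub_pos.mpr hq1).ne'
  have h6 : |x| ≠ 0 := abs_ne_zero.mpr hx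
  have hP (e : ℂ) : ‖qPochC q (e * x)‖ = ‖1 - e * x‖ * ‖qPochC q (e * (x * q : ℝ))‖ := by
    rw [qPochC_eq_one_sub_mul hq0 hq1, norm_mul, Complex.ofReal_mul, mul_assoc e]
  unfold conjWeight
  rw [hP b, hP d, abs_mul, abs_of_pos hq0]
  generalize ‖qPochC q (b * (x * q : ℝ))‖ = B at h1 ⊢
  generalize ‖qPochC q (d * (x * q : ℝ))‖ = D at h2 ⊢
  field_simp

lemma tendsto_mul_pow_zero (hq0 : 0 < q) (hq1 : q < 1) (z : ℝ) :
    Tendsto (fun n : ℕ => ((z * q ^ n : ℝ) : ℂ)) atTop (𝓝 0) := by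
  have h := (tendsto_pow_atTop_nhds_zero_of_lt_one hq0.le hq1).const_mul z
  rw [mul_zero] at h
  exact (Complex.continuous_ofReal.tendsto' 0 0 Complex.ofReal_zero).comp h

lemma summable_conjWeight_nat (hq0 : 0 < q) (hq1 : q < 1) (hb : b.im ≠ 0) (hd : d.im ≠ 0)
    {z : ℝ} (hz : z ≠ 0) : Summable fun n : ℕ => conjWeight q b d (z * q ^ n) := by
  have hx (n : ℕ) : z * q ^ n ≠ 0 := mul_ne_zero hz (pow_pos hq0 n).ne'
  have hpos (n : ℕ) := conjWeight_pos hq0 hq1 hb hd (hx n)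
  refine summable_of_ratio_test_tendsto_lt_one hq1 (.of_forall fun n => (hpos n).ne') ?_
  have hr (n : ℕ) : ‖conjWeight q b d (z * q ^ (n + 1))‖ / ‖conjWeight q b d (z * q ^ n)‖ =
      q * (‖1 - d * (z * q ^ n : ℝ)‖ ^ 2 / ‖1 - b * (z * q ^ n : ℝ)‖ ^ 2) := by
    rw [Real.norm_of_nonneg (hpos _).le, Real.norm_of_nonneg (hpos _).le, pow_succ, ← mul_assoc,
      conjWeight_mul_div hq0 hq1 hb hd (hx n)]
  simp only [hr]
  have ht (e : ℂ) : Tendsto (fun n : ℕ => ‖1 - e * (z * q ^ n : ℝ)‖ ^ 2) atTop (𝓝 1) := by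
    simpa using (((tendsto_mul_pow_zero hq0 hq1 z).const_mul e).const_sub 1).norm.pow 2
  simpa using ((ht d).div (ht b) one_ne_zero).const_mul q

lemma summable_conjWeight_nat_neg (hq0 : 0 < q) (hq1 : q < 1) (hb : b.im ≠ 0) (hd : d.im ≠ 0)
    (h : ‖b‖ ^ 2 < ‖d‖ ^ 2 * q) {z : ℝ} (hz : z ≠ 0) :
    Summable fun n : ℕ => conjWeight q b d (z * (q ^ n)⁻¹) := by
  have hx (n : ℕ) : z * (q ^ n)⁻¹ ≠ 0 := mul_ne_zero hz (inv_pos.mpr (pow_pos hq0 n)).ne'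
  have hpos (n : ℕ) := conjWeight_pos hq0 hq1 hb hd (hx n)
  have hd0 : 0 < ‖d‖ := norm_pos_iff.mpr fun h0 => hd (by simp [h0])
  have hl : q⁻¹ * (‖b‖ ^ 2 / ‖d‖ ^ 2) < 1 := by
    rw [inv_mul_lt_iff₀ hq0, mul_one, div_lt_iff₀ (by positivity), mul_comm]
    exact h
  refine summable_of_ratio_test_tendsto_lt_one hl (.of_forall fun n => (hpos n).ne') ?_
  have hn (e : ℂ) {y : ℝ} (hy : y ≠ 0) : ‖1 - e * y‖ = |y| * ‖(y⁻¹ : ℝ) - e‖ := by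
    have hy' : (y : ℂ) ≠ 0 := Complex.ofReal_ne_zero.mpr hy
    rw [← Real.norm_eq_abs, ← Complex.norm_real, ← norm_mul]
    congr 1
    push_cast
    field_simp
  have hr (n : ℕ) :
      ‖conjWeight q b d (z * (q ^ (n + 1))⁻¹)‖ / ‖conjWeight q b d (z * (q ^ n)⁻¹)‖ =
      q⁻¹ * (‖(z⁻¹ * q * q ^ n : ℝ) - b‖ ^ 2 / ‖(z⁻¹ * q * q ^ n : ℝ) - d‖ ^ 2) := by
    have hy := hx (n + 1)
    have hstep : z * (q ^ n)⁻¹ = z * (q ^ (n + 1))⁻¹ * q := by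
      rw [pow_succ]; field_simp
    have hinv : (z * (q ^ (n + 1))⁻¹)⁻¹ = z⁻¹ * q * q ^ n := by
      rw [pow_succ, mul_inv, inv_inv]; ring
    rw [Real.norm_of_nonneg (hpos _).le, Real.norm_of_nonneg (hpos _).le, ← inv_div, hstep,
      conjWeight_mul_div hq0 hq1 hb hd hy, hn b hy, hn d hy, hinv, mul_inv, inv_div, mul_pow,
      mul_pow, mul_div_mul_left _ _ (pow_ne_zero 2 (abs_ne_zero.mpr hy))]
  simp only [hr]
  have ht (e : ℂ) : Tendsto (fun n : ℕ => ‖(z⁻¹ * q * q ^ n : ℝ) - e‖ ^ 2) atTop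
      (𝓝 (‖e‖ ^ 2)) := by
    simpa using ((tendsto_mul_pow_zero hq0 hq1 (z⁻¹ * q)).sub_const e).norm.pow 2
  exact ((ht b).div (ht d) (by positivity)).const_mul _

lemma summable_conjWeight_int (hq0 : 0 < q) (hq1 : q < 1) (hb : b.im ≠ 0) (hd : d.im ≠ 0)
    (h : ‖b‖ ^ 2 < ‖d‖ ^ 2 * q) {z : ℝ} (hz : z ≠ 0) :
    Summable fun n : ℤ => conjWeight q b d (z * q ^ n) := by
  refine Summable.of_nat_of_neg ?_ ?_
  · simpa using summable_conjWeight_nat hq0 hq1 hb hd hz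
  · simpa using summable_conjWeight_nat_neg hq0 hq1 hb hd h hz

end ConjWeight

lemma Lambda_eq_union (q ζp ζm : ℝ) :
    Lambda q ζp ζm = Set.range (fun n : ℤ => ζp * q ^ n) ∪ Set.range (fun n : ℤ => ζm * q ^ n) := by
  ext x
  simp only [Lambda, Set.mem_ofPred_eq, Set.mem_union, Set.mem_range, exists_or, eq_comm]

lemma ne_zero_of_mem_Lambda {q ζp ζm : ℝ} (hq0 : 0 < q) (hp : ζp ≠ 0) (hm : ζm ≠ 0) {x : ℝ}
    (hx : x ∈ Lambda q ζp ζm) : x ≠ 0 := by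
  obtain ⟨n, rfl | rfl⟩ := hx
  · exact mul_ne_zero hp (zpow_pos hq0 n).ne'
  · exact mul_ne_zero hm (zpow_pos hq0 n).ne'

lemma summable_Lambda {q ζp ζm : ℝ} (hq0 : 0 < q) (hq1 : q < 1) (hζp : 0 < ζp) (hζm : ζm < 0)
    {f : ℝ → ℝ} (hp : Summable fun n : ℤ => f (ζp * q ^ n))
    (hm : Summable fun n : ℤ => f (ζm * q ^ n)) :
    Summable fun x : Lambda q ζp ζm => f x := by
  have hinj {z : ℝ} (hz : z ≠ 0) : Function.Injective fun n : ℤ => z * q ^ n :=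
    (mul_right_injective₀ hz).comp (zpow_right_injective₀ hq0 hq1.ne)
  have hrange {z : ℝ} (hz : z ≠ 0) (hs : Summable fun n : ℤ => f (z * q ^ n)) :
      Summable (f ∘ (↑) : Set.range (fun n : ℤ => z * q ^ n) → ℝ) :=
    (Equiv.ofInjective _ (hinj hz)).summable_iff.mp hs
  rw [Lambda_eq_union]
  refine ((hrange hζp.ne' hp).hasSum.add_disjoint ?_ (hrange hζm.ne hm).hasSum).summable
  rw [Set.disjoint_left]
  rintro _ ⟨n, rfl⟩ ⟨m, hm⟩
  exact ((mul_neg_of_neg_of_pos hζm (zpow_pos hq0 m)).trans (mul_pos hζp (zpow_pos hq0 n))).ne hm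

/-- Principal series (N = 1): for `a = conj b ∈ ℂ∖ℝ`, `c = conj d ∈ ℂ∖ℝ` with
`ab < cd·q`, the weights `W(x)` are strictly positive reals on the lattice `Λ`,
summable, and the normalized weights form a probability distribution on `Λ`
with strictly positive weights. -/
theorem stmt2 (q ζp ζm : ℝ) (hq0 : 0 < q) (hq1 : q < 1) (hζp : 0 < ζp) (hζm : ζm < 0)
    (a b c d : ℂ) (hab : a = (starRingEnd ℂ) b) (ha : a.im ≠ 0)
    (hcd : c = (starRingEnd ℂ) d) (hc : c.im ≠ 0)
    (h : (a * b).re < (c * d).re * q) :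
    (∀ x ∈ Lambda q ζp ζm, 0 < (Wc q a b c d x).re ∧ (Wc q a b c d x).im = 0) ∧
    Summable (fun x : Lambda q ζp ζm => (Wc q a b c d (x : ℝ)).re) ∧
    (∀ x : Lambda q ζp ζm,
      0 < (Wc q a b c d (x : ℝ)).re / ∑' y : Lambda q ζp ζm, (Wc q a b c d (y : ℝ)).re) ∧
    ∑' x : Lambda q ζp ζm,
      (Wc q a b c d (x : ℝ)).re / (∑' y : Lambda q ζp ζm, (Wc q a b c d (y : ℝ)).re) = 1 := by
  subst hab hcd
  have hb : b.im ≠ 0 := by simpa using ha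
  have hd : d.im ≠ 0 := by simpa using hc
  have hbd : ‖b‖ ^ 2 < ‖d‖ ^ 2 * q := by
    simpa only [Complex.conj_mul', ← Complex.ofReal_pow, Complex.ofReal_re] using h
  have hpos {x : ℝ} (hx : x ∈ Lambda q ζp ζm) : 0 < conjWeight q b d x :=
    conjWeight_pos hq0 hq1 hb hd (ne_zero_of_mem_Lambda hq0 hζp.ne' hζm.ne hx)
  have hsum : Summable fun x : Lambda q ζp ζm => conjWeight q b d x :=
    summable_Lambda hq0 hq1 hζp hζm (summable_conjWeight_int hq0 hq1 hb hd hbd hζp.ne')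
      (summable_conjWeight_int hq0 hq1 hb hd hbd hζm.ne)
  have htot : 0 < ∑' x : Lambda q ζp ζm, conjWeight q b d x :=
    hsum.tsum_pos (fun x => (hpos x.2).le) ⟨ζp * q ^ (0 : ℤ), 0, .inl rfl⟩ (hpos ⟨0, .inl rfl⟩)
  simp only [Wc_conj_eq hq0 hq1, Complex.ofReal_re, Complex.ofReal_im]
  refine ⟨fun x hx => ⟨hpos hx, trivial⟩, hsum, fun x => div_pos (hpos x.2) htot, ?_⟩
  rw [tsum_div_const, div_self htot.ne']
end

section
/- Let q, t ∈ (0,1), τ := log_q t, ζ₊ > 0, ζ₋ < 0, and N ∈ ℤ_{≥1}. Then for every X ∈ Ω_N, the (q,t)-interaction V_{q,t}(X) is a well-defined strictly positive real number (in particular, every q-Pochhammer factor occurring in its numerators and denominators is strictly positive). -/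
/-- The infinite q-Pochhammer symbol `(u; q)_∞` (real version). -/
noncomputable def qPochR (q u : ℝ) : ℝ := ∏' n : ℕ, (1 - u * q ^ n)

/-- The theta function `θ_q(v) = (v;q)_∞ (q v⁻¹;q)_∞`. -/
noncomputable def thetaQ (q v : ℝ) : ℝ := qPochR q v * qPochR q (q * v⁻¹)

/-- `ψ_τ(u) = (-u)^{2τ-1} θ_q(tu)/θ_q(t u⁻¹)` with `τ = log_q t`. -/
noncomputable def psiQ (q t u : ℝ) : ℝ :=
  (-u) ^ (2 * Real.logb q t - 1) * thetaQ q (t * u) / thetaQ q (t * u⁻¹)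

/-- A (finite or countably infinite) particle configuration: a countable set of nonzero
reals, whose points can be enumerated from the outside toward 0 on each side, whose
outermost positive (resp. negative) point lies on `ζ₊ q^ℤ` (resp. `ζ₋ q^ℤ`), and in which
any two consecutive points of the same sign have ratio in `t q^{ℤ≥0}`. -/
def IsConfig (q t ζp ζm : ℝ) (X : Set ℝ) : Prop :=
  X.Countable ∧ (0 : ℝ) ∉ X ∧
  (∀ x ∈ X, 0 < x → {y ∈ X | x < y}.Finite) ∧
  (∀ x ∈ X, x < 0 → {y ∈ X | y < x}.Finite) ∧
  (∀ x ∈ X, 0 < x → (∀ y ∈ X, 0 < y → y ≤ x) → ∃ n : ℤ, x = ζp * q ^ n) ∧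
  (∀ x ∈ X, x < 0 → (∀ y ∈ X, y < 0 → x ≤ y) → ∃ n : ℤ, x = ζm * q ^ n) ∧
  (∀ x ∈ X, ∀ y ∈ X, 0 < y → y < x → (∀ z ∈ X, z ≤ y ∨ x ≤ z) → ∃ k : ℕ, y = x * t * q ^ k) ∧
  (∀ x ∈ X, ∀ y ∈ X, y < x → x < 0 → (∀ z ∈ X, z ≤ y ∨ x ≤ z) → ∃ k : ℕ, x = y * t * q ^ k)

/-- The set `Ω_N` of N-particle configurations, realized as finsets of reals. -/
def OmegaN (q t ζp ζm : ℝ) (N : ℕ) : Set (Finset ℝ) :=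
  {X | X.card = N ∧ IsConfig q t ζp ζm ↑X}

/-- The (q,t)-interaction `V_{q,t}(X)`. -/
noncomputable def Vqt (q t : ℝ) (X : Finset ℝ) : ℝ :=
  (∏ x ∈ X, ∏ y ∈ X, if y < x then (x - y) else 1) *
  (∏ x ∈ X, ∏ y ∈ X, if 0 < x ∧ y < x then
      x ^ (2 * Real.logb q t - 1) * qPochR q (q * t⁻¹ * y * x⁻¹) / qPochR q (t * y * x⁻¹)
    else 1) *
  (∏ x ∈ X, ∏ y ∈ X, if x < 0 ∧ y < x then
      |y| ^ (2 * Real.logb q t - 1) * qPochR q (q * t⁻¹ * x * y⁻¹) / qPochR q (t * x * y⁻¹)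
    else 1)

/-- The constant `C_N(k) = ∏_{1≤i<j≤N, i≤k} ψ_τ(ζ₋ζ₊⁻¹ t^{N-i-j+1})`. -/
noncomputable def CNconst (q t ζp ζm : ℝ) (N k : ℕ) : ℝ :=
  ∏ i ∈ Finset.Icc 1 N, ∏ j ∈ Finset.Icc 1 N,
    if i < j ∧ i ≤ k then psiQ q t (ζm * ζp⁻¹ * t ^ ((N : ℤ) - (i : ℤ) - (j : ℤ) + 1)) else 1

/-- The unnormalized N-particle weight
`M̃_N(X) = C_N(|X⁺|) V_{q,t}(X) ∏_{x∈X} W(x; q; a,b,c,d)`. -/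
noncomputable def Mtilde (q t ζp ζm : ℝ) (N : ℕ) (a b c d : ℂ) (X : Finset ℝ) : ℂ :=
  ((CNconst q t ζp ζm N (X.filter (fun x => 0 < x)).card * Vqt q t X : ℝ) : ℂ) *
    ∏ x ∈ X, Wc q a b c d x

/-- The infinite q-Pochhammer symbol is strictly positive for real arguments below one. -/
lemma qPochR_pos {q u : ℝ} (hq0 : 0 < q) (hq1 : q < 1) (hu : u < 1) : 0 < qPochR q u := by
  have hpos : ∀ n : ℕ, 0 < 1 + -u * q ^ n := fun n => by
    have h0 : 0 < q ^ n := pow_pos hq0 n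
    have h1 : q ^ n ≤ 1 := pow_le_one₀ hq0.le hq1.le
    nlinarith
  have hs : Summable fun n : ℕ => -u * q ^ n :=
    (summable_geometric_of_lt_one hq0.le hq1).mul_left _
  have h := Real.rexp_tsum_eq_tprod hpos (Real.summable_log_one_add_of_summable hs)
  have heq : qPochR q u = ∏' n : ℕ, (1 + -u * q ^ n) :=
    tprod_congr fun n => by ring
  rw [heq, ← h]
  exact Real.exp_pos _

/-- Two positive points of a finite configuration are separated by a factor of at least `t`. -/
lemma IsConfig.le_mul_of_pos {q t ζp ζm : ℝ} {X : Finset ℝ} (h : IsConfig q t ζp ζm X)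
    (hq0 : 0 < q) (hq1 : q < 1) (ht0 : 0 < t) {x y : ℝ} (hx : x ∈ X) (hy : y ∈ X)
    (hy0 : 0 < y) (hyx : y < x) : y ≤ x * t := by
  obtain ⟨-, -, -, -, -, -, hstep, -⟩ := h
  obtain ⟨z, hz, hmin⟩ := Finset.exists_min_image (X.filter (y < ·)) id
    ⟨x, Finset.mem_filter.2 ⟨hx, hyx⟩⟩
  rw [Finset.mem_filter] at hz
  have hzx : z ≤ x := hmin x (Finset.mem_filter.2 ⟨hx, hyx⟩)
  obtain ⟨k, hk⟩ := hstep z (Finset.mem_coe.2 hz.1) y (Finset.mem_coe.2 hy) hy0 hz.2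
    fun w hw => (le_or_gt w y).imp_right fun hyw =>
      hmin w (Finset.mem_filter.2 ⟨Finset.mem_coe.1 hw, hyw⟩)
  have hzt : 0 < z * t := mul_pos (hy0.trans hz.2) ht0
  calc y = z * t * q ^ k := hk
    _ ≤ z * t := mul_le_of_le_one_right hzt.le (pow_le_one₀ hq0.le hq1.le)
    _ ≤ x * t := mul_le_mul_of_nonneg_right hzx ht0.le

/-- Two negative points of a finite configuration are separated by a factor of at least `t`. -/
lemma IsConfig.mul_le_of_neg {q t ζp ζm : ℝ} {X : Finset ℝ} (h : IsConfig q t ζp ζm X)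
    (hq0 : 0 < q) (hq1 : q < 1) (ht0 : 0 < t) {x y : ℝ} (hx : x ∈ X) (hy : y ∈ X)
    (hx0 : x < 0) (hyx : y < x) : y * t ≤ x := by
  obtain ⟨-, -, -, -, -, -, -, hstep⟩ := h
  obtain ⟨z, hz, hmax⟩ := Finset.exists_max_image (X.filter (· < x)) id
    ⟨y, Finset.mem_filter.2 ⟨hy, hyx⟩⟩
  rw [Finset.mem_filter] at hz
  have hyz : y ≤ z := hmax y (Finset.mem_filter.2 ⟨hy, hyx⟩)
  obtain ⟨k, hk⟩ := hstep x (Finset.mem_coe.2 hx) z (Finset.mem_coe.2 hz.1) hz.2 hx0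
    fun w hw => (lt_or_ge w x).imp_left fun hwx =>
      hmax w (Finset.mem_filter.2 ⟨Finset.mem_coe.1 hw, hwx⟩)
  have hzt : z * t < 0 := mul_neg_of_neg_of_pos (hz.2.trans hx0) ht0
  have hqk : q ^ k ≤ 1 := pow_le_one₀ hq0.le hq1.le
  calc y * t ≤ z * t := mul_le_mul_of_nonneg_right hyz ht0.le
    _ ≤ z * t * q ^ k := by nlinarith
    _ = x := hk.symm

/-- Both q-Pochhammer factors attached to a ratio `r ≤ t` are strictly positive. -/
lemma qPochR_pair_pos {q t r : ℝ} (hq0 : 0 < q) (hq1 : q < 1) (ht0 : 0 < t) (ht1 : t < 1)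
    (hr : r ≤ t) : 0 < qPochR q (q * t⁻¹ * r) ∧ 0 < qPochR q (t * r) := by
  refine ⟨qPochR_pos hq0 hq1 ?_, qPochR_pos hq0 hq1 (by nlinarith)⟩
  calc q * t⁻¹ * r ≤ q * t⁻¹ * t := by gcongr
    _ = q := inv_mul_cancel_right₀ ht0.ne' q
    _ < 1 := hq1

/-- For `q, t ∈ (0,1)`, every N-particle configuration `X ∈ Ω_N` has strictly positive
interaction `V_{q,t}(X) > 0`; in particular every q-Pochhammer factor occurring in it is
strictly positive. -/
theorem stmt6 (q t ζp ζm : ℝ) (hq0 : 0 < q) (hq1 : q < 1) (ht0 : 0 < t) (ht1 : t < 1)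
    (hζp : 0 < ζp) (hζm : ζm < 0) (N : ℕ) (hN : 1 ≤ N) :
    ∀ X ∈ OmegaN q t ζp ζm N,
      0 < Vqt q t X ∧
      (∀ x ∈ X, ∀ y ∈ X, y < x →
        (0 < x → 0 < qPochR q (q * t⁻¹ * y * x⁻¹) ∧ 0 < qPochR q (t * y * x⁻¹)) ∧
        (x < 0 → 0 < qPochR q (q * t⁻¹ * x * y⁻¹) ∧ 0 < qPochR q (t * x * y⁻¹))) := by
  rintro X ⟨-, hX⟩
  have hne : ∀ x ∈ X, x ≠ 0 := fun x hx h0 => hX.2.1 (h0 ▸ Finset.mem_coe.2 hx)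
  have hfac : ∀ x ∈ X, ∀ y ∈ X, y < x →
      (0 < x → 0 < qPochR q (q * t⁻¹ * y * x⁻¹) ∧ 0 < qPochR q (t * y * x⁻¹)) ∧
      (x < 0 → 0 < qPochR q (q * t⁻¹ * x * y⁻¹) ∧ 0 < qPochR q (t * x * y⁻¹)) := by
    intro x hx y hy hyx
    refine ⟨fun hx0 => ?_, fun hx0 => ?_⟩
    · have hr : y / x ≤ t := by
        rw [div_le_iff₀ hx0, mul_comm]
        rcases (hne y hy).lt_or_gt with hy0 | hy0
        · exact hy0.le.trans (mul_pos hx0 ht0).le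
        · exact hX.le_mul_of_pos hq0 hq1 ht0 hx hy hy0 hyx
      simpa only [div_eq_mul_inv, mul_assoc] using qPochR_pair_pos hq0 hq1 ht0 ht1 hr
    · have hr : x / y ≤ t := by
        rw [div_le_iff_of_neg (hyx.trans hx0), mul_comm]
        exact hX.mul_le_of_neg hq0 hq1 ht0 hx hy hx0 hyx
      simpa only [div_eq_mul_inv, mul_assoc] using qPochR_pair_pos hq0 hq1 ht0 ht1 hr
  refine ⟨mul_pos (mul_pos ?_ ?_) ?_, hfac⟩
  all_goals
    refine Finset.prod_pos fun x hx => Finset.prod_pos fun y hy => ?_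
    split_ifs with h
  · exact sub_pos.2 h
  · exact one_pos
  · obtain ⟨hnum, hden⟩ := (hfac x hx y hy h.2).1 h.1
    exact div_pos (mul_pos (Real.rpow_pos_of_pos h.1 _) hnum) hden
  · exact one_pos
  · obtain ⟨hnum, hden⟩ := (hfac x hx y hy h.2).2 h.1
    exact div_pos (mul_pos (Real.rpow_pos_of_pos (abs_pos.2 (hne y hy)) _) hnum) hden
  · exact one_pos
end
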